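/- Let I be a nonempty finite set of nonnegative integers with m = max(I), and I⁻ = I \ {m}. Then for n > m, the number of even signed permutations in the type D Coxeter group D_n with descent set exactly I satisfies d_D(I;n) = C(n,m)·2^{n−m−1}·d_B(I⁻;m) − d_D(I⁻;n). -/

import Mathlib

/-- The descent set of a permutation of `Fin n`, with positions 1-indexed:
`i ∈ descSet n π` iff `1 ≤ i ≤ n-1` and `π_i > π_{i+1}` (1-indexed entries). -/
def descSet (n : ℕ) (π : Equiv.Perm (Fin n)) : Finset ℕ :=
  (Finset.range n).filter fun i =>
    ∃ h : 0 < i ∧ i < n, π ⟨i, h.2⟩ < π ⟨i - 1, by omega⟩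

/-- `dA I n` is the number of permutations in `S_n` with descent set exactly `I`. -/
def dA (I : Finset ℕ) (n : ℕ) : ℕ :=
  (Finset.univ.filter fun π : Equiv.Perm (Fin n) => descSet n π = I).card

/-- A signed permutation of `[n]` is encoded as a pair `(π, ε)`: the entry in
(1-indexed) position `i` is `π_i` with sign `−` iff `ε` is true there.
`signedVal n π ε i` is that entry `β_i ∈ {±1,…,±n}` for `1 ≤ i ≤ n`, and `0`
otherwise (so in particular `β₀ = 0`). -/
def signedVal (n : ℕ) (π : Equiv.Perm (Fin n)) (ε : Fin n → Bool) (i : ℕ) : ℤ :=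
  if h : 1 ≤ i ∧ i ≤ n then
    (if ε ⟨i - 1, by omega⟩ then -(((π ⟨i - 1, by omega⟩ : ℕ) : ℤ) + 1)
     else ((π ⟨i - 1, by omega⟩ : ℕ) : ℤ) + 1)
  else 0

/-- The type `B` descent set `Des β = {i ≥ 0 : β_i > β_{i+1}} ⊆ {0,…,n−1}`,
with the convention `β₀ = 0`. -/
def descSetB (n : ℕ) (π : Equiv.Perm (Fin n)) (ε : Fin n → Bool) : Finset ℕ :=
  (Finset.range n).filter fun i => signedVal n π ε (i + 1) < signedVal n π ε i

/-- `dB I n` is the number of signed permutations in the hyperoctahedral group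
`B_n` with descent set exactly `I`. -/
def dB (I : Finset ℕ) (n : ℕ) : ℕ :=
  (Finset.univ.filter fun βε : Equiv.Perm (Fin n) × (Fin n → Bool) =>
    descSetB n βε.1 βε.2 = I).card

/-- `dD I n` is the number of elements of the type `D` Coxeter group `D_n`
(signed permutations with an even number of negative entries) with descent set
exactly `I`. -/
def dD (I : Finset ℕ) (n : ℕ) : ℕ :=
  (Finset.univ.filter fun βε : Equiv.Perm (Fin n) × (Fin n → Bool) =>
    descSetB n βε.1 βε.2 = I ∧
      Even (Finset.univ.filter fun i => βε.2 i = true).card).card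

/-- number of negative entries -/
def negCount {k : ℕ} (ε : Fin k → Bool) : ℕ := (Finset.univ.filter fun i => ε i = true).card

/-- value with sign -/
def tval (s : Bool) (v : ℕ) : ℤ := if s then -((v : ℤ) + 1) else (v : ℤ) + 1

lemma signedVal_zero (n : ℕ) (π : Equiv.Perm (Fin n)) (ε : Fin n → Bool) :
    signedVal n π ε 0 = 0 := by
  simp [signedVal]

lemma signedVal_succ (n : ℕ) (π : Equiv.Perm (Fin n)) (ε : Fin n → Bool) (i : Fin n) :
    signedVal n π ε (i + 1) = tval (ε i) (π i) := by
  have : 1 ≤ (i : ℕ) + 1 ∧ (i : ℕ) + 1 ≤ n := by omega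
  simp [signedVal, tval, this]

lemma tval_inj {s t : Bool} {a b : ℕ} (h : tval s a = tval t b) : a = b := by
  cases s <;> cases t <;> simp [tval] at h <;> omega

lemma tval_lt_iff {m n : ℕ} (g : Fin m → Fin n) (hg : StrictMono g) (s t : Bool) (a b : Fin m) :
    tval s (g a) < tval t (g b) ↔ tval s a < tval t b := by
  have h1 : (g a : ℕ) < g b ↔ (a : ℕ) < b := hg.lt_iff_lt
  have h2 : (g b : ℕ) < g a ↔ (b : ℕ) < a := hg.lt_iff_lt
  cases s <;> cases t <;> simp [tval] <;> omega

lemma zero_lt_tval (s : Bool) (a : ℕ) : 0 < tval s a ↔ s = false := by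
  cases s <;> simp [tval]

lemma tval_lt_zero (s : Bool) (a : ℕ) : tval s a < 0 ↔ s = true := by
  cases s <;> simp [tval] <;> omega

lemma negCount_perm {k : ℕ} (ε : Fin k → Bool) (τ : Equiv.Perm (Fin k)) :
    negCount (ε ∘ τ) = negCount ε := by
  unfold negCount
  exact Finset.card_equiv τ (by simp)

lemma negCount_append {m k : ℕ} (ε : Fin m → Bool) (δ : Fin k → Bool) :
    negCount (Fin.append ε δ) = negCount ε + negCount δ := by
  simp only [negCount, Finset.card_filter]
  rw [Fin.sum_univ_add]
  simp

lemma card_sign_parity (k p : ℕ) :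
    (Finset.univ.filter fun δ : Fin (k + 1) → Bool => Even (p + negCount δ)).card = 2 ^ k := by
  have hflip : ∀ δ : Fin (k + 1) → Bool, negCount (Function.update δ 0 (!δ 0)) + (δ 0).toNat
      = negCount δ + (!δ 0).toNat := by
    intro δ
    simp only [negCount, Finset.card_filter, Fin.sum_univ_succ]
    cases h : δ 0 <;> simp [add_comm]
  have hinv : Function.Involutive (fun δ : Fin (k + 1) → Bool => Function.update δ 0 (!δ 0)) := by
    intro δ
    simp
  have h1 : (Finset.univ.filter fun δ : Fin (k + 1) → Bool => Even (p + negCount δ)).card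
      = (Finset.univ.filter fun δ : Fin (k + 1) → Bool => ¬ Even (p + negCount δ)).card := by
    refine Finset.card_equiv hinv.toPerm ?_
    intro δ
    have := hflip δ
    simp only [Finset.mem_filter, Finset.mem_univ, true_and, Function.Involutive.coe_toPerm]
    cases h : δ 0 <;> simp [h] at this ⊢ <;> grind
  have h2 := Finset.card_filter_add_card_filter_not (s := (Finset.univ : Finset (Fin (k+1) → Bool)))
    (fun δ => Even (p + negCount δ))
  simp [pow_succ] at h2
  simp at h1
  omega

/-- tail is increasing -/
def Inc {k : ℕ} (c : Equiv.Perm (Fin k) × (Fin k → Bool)) : Prop :=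
  Monotone (fun i : Fin k => tval (c.2 i) (c.1 i))

open Classical in
lemma card_inc (k p : ℕ) :
    (Finset.univ.filter fun c : Equiv.Perm (Fin (k + 1)) × (Fin (k + 1) → Bool) =>
      Inc c ∧ Even (p + negCount c.2)).card = 2 ^ k := by
  rw [← card_sign_parity k p]
  refine Finset.card_bij (fun c _ => c.2 ∘ c.1.symm) ?_ ?_ ?_
  · rintro ⟨τ, ε⟩ h
    simp only [Finset.mem_filter, Finset.mem_univ, true_and] at h ⊢
    rw [negCount_perm ε τ.symm]
    exact h.2
  · rintro ⟨τ, ε⟩ h ⟨τ', ε'⟩ h' heq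
    simp only [Finset.mem_filter, Finset.mem_univ, true_and] at h h' heq
    set δ := ε ∘ τ.symm with hδ
    have e1 : ε = δ ∘ τ := by ext; simp [hδ]
    have e2 : ε' = δ ∘ τ' := by rw [heq]; ext; simp
    have i1 := h.1
    have i2 := h'.1
    unfold Inc at i1 i2
    rw [e1] at i1
    rw [e2] at i2
    have := Tuple.unique_monotone (f := fun v : Fin (k+1) => tval (δ v) v) i1 i2
    have h3 : τ = τ' := by
      ext i
      exact tval_inj (congrFun this i)
    subst h3
    rw [e1, e2]
  · intro δ h
    simp only [Finset.mem_filter, Finset.mem_univ, true_and] at h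
    let τ := Tuple.sort (fun v : Fin (k+1) => tval (δ v) v)
    refine ⟨(τ, δ ∘ τ), ?_, ?_⟩
    · simp only [Finset.mem_filter, Finset.mem_univ, true_and]
      rw [negCount_perm]
      exact ⟨Tuple.monotone_sort (fun v : Fin (k+1) => tval (δ v) v), h⟩
    · ext; simp

/-- the finsets of size m -/
abbrev MSub (m k : ℕ) := {S : Finset (Fin (m + k)) // S.card = m}

lemma compl_card {m k : ℕ} (S : MSub m k) : (S.1ᶜ).card = k := by
  rw [Finset.card_compl, S.2]; simp

/-- shuffle -/
def sumE {m k : ℕ} (S : MSub m k) : Fin m ⊕ Fin k ≃ Fin (m + k) :=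
  finSumEquivOfFinset S.2 (compl_card S)

/-- signed permutations -/
abbrev SP (n : ℕ) := Equiv.Perm (Fin n) × (Fin n → Bool)

/-- gluing map -/
def glue {m k : ℕ} (x : MSub m k × (SP m × SP k)) : SP (m + k) :=
  (finSumFinEquiv.symm.trans ((Equiv.Perm.sumCongr x.2.1.1 x.2.2.1).trans (sumE x.1)),
    Fin.append x.2.1.2 x.2.2.2)

lemma glue_left {m k : ℕ} (x : MSub m k × (SP m × SP k)) (i : Fin m) :
    (glue x).1 (Fin.castAdd k i) = x.1.1.orderEmbOfFin x.1.2 (x.2.1.1 i) := by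
  simp [glue, sumE]

lemma glue_right {m k : ℕ} (x : MSub m k × (SP m × SP k)) (i : Fin k) :
    (glue x).1 (Fin.natAdd m i) = x.1.1ᶜ.orderEmbOfFin (compl_card x.1) (x.2.2.1 i) := by
  simp [glue, sumE]

lemma glue_bij (m k : ℕ) : Function.Bijective (glue (m := m) (k := k)) := by
  rw [Fintype.bijective_iff_surjective_and_card]
  constructor
  · rintro ⟨π, ε⟩
    let S : MSub m k := ⟨Finset.univ.image (fun i : Fin m => π (Fin.castAdd k i)), by
      rw [Finset.card_image_of_injective]
      · simp
      · intro a b h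
        simpa using h⟩
    let ρ : Equiv.Perm (Fin m ⊕ Fin k) := (finSumFinEquiv.trans π).trans (sumE S).symm
    have hρ : ρ ∈ (Equiv.Perm.sumCongrHom (Fin m) (Fin k)).range := by
      apply Equiv.Perm.mem_sumCongrHom_range_of_perm_mapsTo_inl
      rintro _ ⟨i, rfl⟩
      have h1 : π (Fin.castAdd k i) ∈ Set.range (S.1.orderEmbOfFin S.2) := by
        rw [Finset.range_orderEmbOfFin]
        simp [S]
      obtain ⟨j, hj⟩ := h1
      refine ⟨j, ?_⟩
      simp only [ρ, Equiv.trans_apply, finSumFinEquiv_apply_left]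
      rw [Equiv.eq_symm_apply, ← hj]
      simp [sumE]
    obtain ⟨⟨σ, τ⟩, h⟩ := hρ
    refine ⟨(S, ((σ, fun i => ε (Fin.castAdd k i)), (τ, fun i => ε (Fin.natAdd m i)))), ?_⟩
    have h' : Equiv.Perm.sumCongr σ τ = ρ := h
    apply Prod.ext
    · simp only [glue]
      rw [h']
      ext i
      simp [ρ]
    · simp only [glue]
      exact (Fin.appendEquiv m k).right_inv ε
  · simp only [Fintype.card_prod, Fintype.card_finset_len, Fintype.card_perm, Fintype.card_fin,
      Fintype.card_fun, Fintype.card_bool]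
    rw [← Nat.add_choose_mul_factorial_mul_factorial m k, Nat.choose_symm_add, pow_add]
    ring

lemma sv_left {m k : ℕ} (x : MSub m k × (SP m × SP k)) (i : ℕ) (hi : i < m) :
    (signedVal (m + k) (glue x).1 (glue x).2 (i + 1) < signedVal (m + k) (glue x).1 (glue x).2 i) ↔
    (signedVal m x.2.1.1 x.2.1.2 (i + 1) < signedVal m x.2.1.1 x.2.1.2 i) := by
  have key : ∀ j : Fin m, signedVal (m + k) (glue x).1 (glue x).2 (j + 1) =
      tval (x.2.1.2 j) (x.1.1.orderEmbOfFin x.1.2 (x.2.1.1 j)) := by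
    intro j
    have := signedVal_succ (m + k) (glue x).1 (glue x).2 (Fin.castAdd k j)
    rw [glue_left] at this
    simpa [glue] using this
  have k1 := key ⟨i, hi⟩
  have k2 := signedVal_succ m x.2.1.1 x.2.1.2 ⟨i, hi⟩
  simp only at k1 k2
  rw [k1, k2]
  rcases i with _ | i
  · rw [signedVal_zero, signedVal_zero, tval_lt_zero, tval_lt_zero]
  · have k3 := key ⟨i, by omega⟩
    have k4 := signedVal_succ m x.2.1.1 x.2.1.2 ⟨i, by omega⟩
    simp only at k3 k4
    rw [k3, k4]
    exact tval_lt_iff _ (OrderEmbedding.strictMono _) _ _ _ _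

lemma sv_right {m k : ℕ} (x : MSub m (k + 1) × (SP m × SP (k + 1))) :
    (∀ i, m < i → i < m + (k + 1) →
      ¬ signedVal (m + (k + 1)) (glue x).1 (glue x).2 (i + 1)
        < signedVal (m + (k + 1)) (glue x).1 (glue x).2 i) ↔ Inc x.2.2 := by
  have key : ∀ j : Fin (k + 1), signedVal (m + (k + 1)) (glue x).1 (glue x).2 (m + j + 1) =
      tval (x.2.2.2 j) (x.1.1ᶜ.orderEmbOfFin (compl_card x.1) (x.2.2.1 j)) := by
    intro j
    have := signedVal_succ (m + (k + 1)) (glue x).1 (glue x).2 (Fin.natAdd m j)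
    rw [glue_right] at this
    simpa [glue] using this
  have key2 : ∀ i : Fin k, (signedVal (m + (k + 1)) (glue x).1 (glue x).2 (m + i + 1 + 1)
        < signedVal (m + (k + 1)) (glue x).1 (glue x).2 (m + i + 1)) ↔
      tval (x.2.2.2 i.succ) (x.2.2.1 i.succ) < tval (x.2.2.2 i.castSucc) (x.2.2.1 i.castSucc) := by
    intro i
    have k1 := key i.castSucc
    have k2 := key i.succ
    simp only [Fin.val_castSucc, Fin.val_succ, ← add_assoc] at k1 k2
    rw [k1, k2]
    exact tval_lt_iff _ (OrderEmbedding.strictMono _) _ _ _ _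
  unfold Inc
  rw [Fin.monotone_iff_le_succ]
  constructor
  · intro h i
    have := h (m + i + 1) (by omega) (by omega)
    rw [key2] at this
    exact not_lt.mp this
  · intro h i h1 h2
    obtain ⟨j, rfl⟩ : ∃ j : Fin k, i = m + j + 1 := ⟨⟨i - m - 1, by omega⟩, by simp; omega⟩
    rw [key2]
    exact not_lt.mpr (h j)

/-- the prefix-and-tail condition -/
def Good (m : ℕ) (J : Finset ℕ) {n : ℕ} (b : SP n) : Prop :=
  (descSetB n b.1 b.2).filter (· < m) = J ∧ ∀ i ∈ descSetB n b.1 b.2, i ≤ m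

lemma good_glue {m k : ℕ} (J : Finset ℕ) (x : MSub m (k + 1) × (SP m × SP (k + 1))) :
    Good m J (glue x) ↔ descSetB m x.2.1.1 x.2.1.2 = J ∧ Inc x.2.2 := by
  unfold Good
  refine and_congr ?_ ?_
  · have : (descSetB (m + (k + 1)) (glue x).1 (glue x).2).filter (· < m)
        = descSetB m x.2.1.1 x.2.1.2 := by
      ext i
      simp only [descSetB, Finset.mem_filter, Finset.mem_range]
      constructor
      · rintro ⟨⟨h1, h2⟩, h3⟩
        exact ⟨h3, (sv_left x i h3).1 h2⟩
      · rintro ⟨h3, h2⟩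
        exact ⟨⟨by omega, (sv_left x i h3).2 h2⟩, h3⟩
    rw [this]
  · rw [← sv_right]
    simp only [descSetB, Finset.mem_filter, Finset.mem_range]
    constructor
    · intro h i h1 h2 h3
      have := h i ⟨h2, h3⟩
      omega
    · intro h i h1
      by_contra hc
      exact h i (by omega) h1.1 h1.2

open Classical in
lemma card_good (m k : ℕ) (J : Finset ℕ) :
    (Finset.univ.filter fun b : SP (m + (k + 1)) => Good m J b ∧ Even (negCount b.2)).card
      = (m + (k + 1)).choose m * 2 ^ k * dB J m := by
  have h1 : (Finset.univ.filter fun x : MSub m (k + 1) × (SP m × SP (k + 1)) =>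
      descSetB m x.2.1.1 x.2.1.2 = J ∧ (Inc x.2.2 ∧ Even (negCount x.2.1.2 + negCount x.2.2.2))).card
      = (Finset.univ.filter fun b : SP (m + (k + 1)) => Good m J b ∧ Even (negCount b.2)).card := by
    refine Finset.card_equiv (Equiv.ofBijective _ (glue_bij m (k + 1))) ?_
    intro x
    simp only [Finset.mem_filter, Finset.mem_univ, true_and, Equiv.ofBijective_apply]
    rw [good_glue, and_assoc]
    simp only [glue, negCount_append]
  rw [← h1, Finset.card_filter, Fintype.sum_prod_type]
  change (∑ _x : MSub m (k + 1), ∑ y : SP m × SP (k + 1), if descSetB m y.1.1 y.1.2 = J ∧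
    (Inc y.2 ∧ Even (negCount y.1.2 + negCount y.2.2)) then 1 else 0) = _
  simp only [Finset.sum_const, Finset.card_univ, Fintype.card_finset_len, Fintype.card_fin,
    smul_eq_mul]
  rw [Fintype.sum_prod_type, mul_assoc]
  congr 1
  unfold dB
  rw [Finset.card_filter, Finset.mul_sum]
  refine Finset.sum_congr rfl ?_
  intro b _
  by_cases hb : descSetB m b.1 b.2 = J
  · simp only [hb, true_and, if_true, mul_one]
    rw [← Finset.card_filter]
    exact card_inc k _
  · simp [hb]

/-- Theorem 5.5: for nonempty `I` of nonnegative integers with max `m` and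
`n > m`, `d_D(I;n) = C(n,m) 2^{n−m−1} d_B(I⁻;m) − d_D(I⁻;n)`. -/
theorem stmt_19 (I : Finset ℕ) (hne : I.Nonempty)
    (m : ℕ) (hm : m = I.sup id) (n : ℕ) (hn : m < n) :
    (dD I n : ℤ) =
      (n.choose m : ℤ) * 2 ^ (n - m - 1) * dB (I.erase m) m
        - dD (I.erase m) n := by

  classical
  obtain ⟨k, rfl⟩ : ∃ k, n = m + (k + 1) := ⟨n - m - 1, by omega⟩
  have hmI : m ∈ I := by
    obtain ⟨i, hi, h⟩ := Finset.exists_mem_eq_sup I hne id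
    rw [hm, h]; exact hi
  have hle : ∀ i ∈ I, i ≤ m := by
    intro i hi
    rw [hm]; exact Finset.le_sup (f := id) hi
  have hg := card_good m k (I.erase m)
  have hsplit : ∀ b : SP (m + (k + 1)), Good m (I.erase m) b ↔
      (descSetB _ b.1 b.2 = I ∨ descSetB _ b.1 b.2 = I.erase m) := by
    intro b
    unfold Good
    generalize descSetB _ b.1 b.2 = D
    constructor
    · rintro ⟨h1, h2⟩
      have h3 : ∀ i, i ≠ m → (i ∈ D ↔ i ∈ I) := by
        intro i hi
        have h4 := Finset.ext_iff.1 h1 i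
        simp only [Finset.mem_filter, Finset.mem_erase] at h4
        have := h2 i
        grind
      by_cases hD : m ∈ D
      · left; ext i; grind
      · right; ext i; grind
    · rintro (rfl | rfl)
      · refine ⟨?_, hle⟩
        ext i; grind
      · constructor
        · ext i; grind
        · intro i hi; grind
  have hsum : dD I (m + (k + 1)) + dD (I.erase m) (m + (k + 1))
      = (m + (k + 1)).choose m * 2 ^ k * dB (I.erase m) m := by
    rw [← hg]
    unfold dD
    rw [← Finset.card_union_of_disjoint]
    · congr 1
      ext b
      simp only [Finset.mem_union, Finset.mem_filter, Finset.mem_univ, true_and, hsplit, negCount]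
      tauto
    · rw [Finset.disjoint_left]
      intro b h1 h2
      simp only [Finset.mem_filter, Finset.mem_univ, true_and] at h1 h2
      have := h1.1.symm.trans h2.1
      rw [this] at hmI
      simp at hmI
  have hk : m + (k + 1) - m - 1 = k := by omega
  rw [hk, eq_sub_iff_add_eq]
  exact_mod_cast hsum
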